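/- Every connected diamond-minimal graph is isomorphic either to K_4 or to a subdivision of the diamond. -/

import Mathlib

open SimpleGraph

variable {α β : Type*}

/-- A model of `H` in `G`: a family of pairwise disjoint nonempty vertex subsets of `G`,
each inducing a connected subgraph, such that for every edge `h h'` of `H` there is an
edge of `G` between `V h` and `V h'`. -/
def IsMinorModel (G : SimpleGraph α) (H : SimpleGraph β) (V : β → Set α) : Prop :=
  (∀ h, (V h).Nonempty) ∧
  (Pairwise fun h h' => Disjoint (V h) (V h')) ∧
  (∀ h, (G.induce (V h)).Connected) ∧
  ∀ h h', H.Adj h h' → ∃ x ∈ V h, ∃ y ∈ V h', G.Adj x y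

/-- `H` is a minor of `G`. -/
def HasMinor (G : SimpleGraph α) (H : SimpleGraph β) : Prop :=
  ∃ V : β → Set α, IsMinorModel G H V

/-- `G` is `H`-minimal: `H` is a minor of `G`, but for every vertex `x` of `G`,
`H` is not a minor of `G − x`. -/
def MinorMinimal (G : SimpleGraph α) (H : SimpleGraph β) : Prop :=
  HasMinor G H ∧ ∀ x : α, ¬ HasMinor (G.induce {y | y ≠ x}) H

/-- A graph is 2-connected if it has at least 3 vertices, is connected, and stays
connected after deleting any single vertex. -/
def TwoConnected [Fintype α] (G : SimpleGraph α) : Prop :=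
  3 ≤ Fintype.card α ∧ G.Connected ∧ ∀ v : α, (G.induce {w | w ≠ v}).Connected

/-- `G` is a cycle: connected and 2-regular. -/
def IsCycleGraph (G : SimpleGraph α) : Prop :=
  G.Connected ∧ ∀ v : α, (G.neighborSet v).ncard = 2
/-- `G` is a subdivision of `H`: `G` is obtained from `H` by replacing each edge by a
path between (the images of) its endpoints, these paths being internally disjoint from
each other and from the (images of the) vertices of `H`. -/
def IsSubdivision (G : SimpleGraph α) (H : SimpleGraph β) : Prop :=
  ∃ v : β → α, Function.Injective v ∧
    ∃ P : ∀ ⦃a b : β⦄, H.Adj a b → G.Walk (v a) (v b),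
      (∀ a b (h : H.Adj a b), (P h).IsPath) ∧
      (∀ a b (h : H.Adj a b), P h.symm = (P h).reverse) ∧
      (∀ a b (h : H.Adj a b) a' b' (h' : H.Adj a' b'), s(a, b) ≠ s(a', b') →
        ∀ x, x ∈ (P h).support → x ∈ (P h').support → x = v a ∨ x = v b) ∧
      (∀ a b (h : H.Adj a b) (c : β), v c ∈ (P h).support → c = a ∨ c = b) ∧
      (∀ x : α, (∃ c, x = v c) ∨ ∃ (a b : β) (h : H.Adj a b), x ∈ (P h).support) ∧
      (∀ x y : α, G.Adj x y ↔ ∃ (a b : β) (h : H.Adj a b), s(x, y) ∈ (P h).edges)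

/-- `G` is a wheel: an induced cycle plus one additional vertex adjacent to at least
3 vertices of the cycle. -/
def IsWheel (G : SimpleGraph α) : Prop :=
  ∃ w : α, ((G.induce {u | u ≠ w}).Connected ∧
      ∀ u : {u : α // u ≠ w}, ((G.induce {u | u ≠ w}).neighborSet u).ncard = 2) ∧
    3 ≤ (G.neighborSet w).ncard

/-- The diamond: `K₄` minus one edge. -/
def diamondGraph : SimpleGraph (Fin 4) :=
  (⊤ : SimpleGraph (Fin 4)).deleteEdges {s(0, 1)}

namespace SimpleGraph

variable {V : Type*} {G : SimpleGraph V} {u v w x y : V}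

namespace Walk

theorem isPath_append_iff (p : G.Walk u v) (q : G.Walk v w) :
    (p.append q).IsPath ↔
      p.IsPath ∧ q.IsPath ∧ ∀ x ∈ p.support, x ∈ q.support → x = v := by
  have hq : q.support = v :: q.support.tail := q.cons_tail_support.symm
  have hv : v ∈ p.support := p.end_mem_support
  simp only [isPath_def, support_append, List.nodup_append]
  constructor
  · rintro ⟨h1, h2, h3⟩
    refine ⟨h1, ?_, fun x hx hxq => ?_⟩
    · rw [hq, List.nodup_cons]
      exact ⟨fun h => h3 v hv v h rfl, h2⟩
    · rw [hq, List.mem_cons] at hxq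
      exact hxq.resolve_right fun h => h3 x hx x h rfl
  · rintro ⟨h1, h2, h3⟩
    rw [hq, List.nodup_cons] at h2
    refine ⟨h1, h2.2, fun a ha b hb hab => ?_⟩
    subst hab
    have := h3 a ha (List.mem_of_mem_tail hb)
    subst this
    exact h2.1 hb

theorem exists_interior_of_notMem_edges (p : G.Walk u v) (huv : u ≠ v) (h : s(u, v) ∉ p.edges) :
    ∃ a ∈ p.support, a ≠ u ∧ a ≠ v := by
  cases p with
  | nil => exact absurd rfl huv
  | @cons _ w _ hw p =>
    refine ⟨w, by simp, hw.ne', ?_⟩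
    rintro rfl
    simp at h

theorem IsPath.eq_or_eq_of_mem_edges {p : G.Walk u v} (hp : p.IsPath) (h : s(u, v) ∈ p.edges)
    (hx : x ∈ p.support) : x = u ∨ x = v := by
  cases p with
  | nil => simp at h
  | @cons _ w _ hw p =>
    rw [cons_isPath_iff] at hp
    rw [edges_cons, List.mem_cons] at h
    rcases h with h | h
    · have hwv : v = w := by
        rcases Sym2.eq_iff.1 h with h | h
        · exact h.2
        · exact absurd h.1 hw.ne
      subst hwv
      have := Walk.eq_nil_iff_nil.2 (isPath_iff_nil.1 hp.1)
      subst this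
      simpa using hx
    · exact absurd (p.fst_mem_support_of_mem_edges h) hp.2

theorem exists_shortcut_append (p : G.Walk u x) (q : G.Walk x y) (r : G.Walk y v)
    (hp : (p.append (q.append r)).IsPath) (h : G.Adj x y) (hq : s(x, y) ∉ q.edges) :
    ∃ p' : G.Walk u v, p'.IsPath ∧ p'.support ⊆ (p.append (q.append r)).support ∧
      (∀ e ∈ p'.edges, e ∈ (p.append (q.append r)).edges ∨ e = s(x, y)) ∧
      ∃ z ∈ (p.append (q.append r)).support, z ∉ p'.support := by
  obtain ⟨z, hz, hzx, hzy⟩ := q.exists_interior_of_notMem_edges h.ne hq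
  simp only [isPath_append_iff, mem_support_append_iff] at hp
  refine ⟨p.append (cons h r), ?_, ?_, ?_, z, ?_, ?_⟩
  · simp only [isPath_append_iff, cons_isPath_iff, support_cons, List.mem_cons]
    have := h.ne
    grind [start_mem_support, end_mem_support]
  · intro a
    simp only [mem_support_append_iff, support_cons, List.mem_cons]
    grind [start_mem_support, end_mem_support]
  · intro e
    simp only [edges_append, List.mem_append, edges_cons, List.mem_cons]
    grind
  · simp only [mem_support_append_iff]
    grind
  · simp only [mem_support_append_iff, support_cons, List.mem_cons]
    grind

theorem IsPath.exists_shortcut {p : G.Walk u v} (hp : p.IsPath) (hx : x ∈ p.support)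
    (hy : y ∈ p.support) (h : G.Adj x y) (he : s(x, y) ∉ p.edges) :
    ∃ p' : G.Walk u v, p'.IsPath ∧ p'.support ⊆ p.support ∧
      (∀ e ∈ p'.edges, e ∈ p.edges ∨ e = s(x, y)) ∧ ∃ z ∈ p.support, z ∉ p'.support := by
  obtain ⟨p₁, p₂, rfl⟩ := Walk.mem_support_iff_exists_append.1 hx
  rw [mem_support_append_iff] at hy
  simp only [edges_append, List.mem_append, not_or] at he
  rcases hy with hy | hy
  · obtain ⟨p₃, p₄, rfl⟩ := Walk.mem_support_iff_exists_append.1 hy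
    simp only [edges_append, List.mem_append, not_or] at he
    rw [← append_assoc] at hp ⊢
    rw [Sym2.eq_swap] at he ⊢
    exact exists_shortcut_append _ _ _ hp h.symm he.1.2
  · obtain ⟨p₃, p₄, rfl⟩ := Walk.mem_support_iff_exists_append.1 hy
    simp only [edges_append, List.mem_append, not_or] at he
    exact exists_shortcut_append _ _ _ hp h he.2.1

theorem exists_isPath_first_mem (S : Set V) (p : G.Walk u v) (hv : v ∈ S) :
    ∃ w ∈ S, ∃ q : G.Walk u w, q.IsPath ∧ q.support ⊆ p.support ∧
      ∀ x ∈ q.support, x ∈ S → x = w := by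
  classical
  suffices h : ∃ w ∈ S, ∃ q : G.Walk u w, q.support ⊆ p.support ∧
      ∀ x ∈ q.support, x ∈ S → x = w by
    obtain ⟨w, hw, q, hq, hqS⟩ := h
    exact ⟨w, hw, q.bypass, q.bypass_isPath, fun x hx => hq (q.support_bypass_subset_support hx),
      fun x hx => hqS x (q.support_bypass_subset_support hx)⟩
  induction p with
  | nil => exact ⟨_, hv, nil, by simp, by simp⟩
  | @cons a b c h p ih =>
    by_cases ha : a ∈ S
    · exact ⟨a, ha, nil, by simp, by simp⟩
    · obtain ⟨w, hw, q, hq, hqS⟩ := ih hv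
      refine ⟨w, hw, cons h q, ?_, ?_⟩
      · simp only [support_cons]
        exact List.cons_subset_cons _ hq
      · intro x hx hxS
        rw [support_cons, List.mem_cons] at hx
        rcases hx with rfl | hx
        · exact absurd hxS ha
        · exact hqS x hx hxS

end Walk

theorem Connected.exists_isPath_of_induce {S : Set V} (hS : (G.induce S).Connected)
    (hx : x ∈ S) (hy : y ∈ S) :
    ∃ p : G.Walk x y, p.IsPath ∧ ∀ z ∈ p.support, z ∈ S := by
  obtain ⟨p, hp⟩ := (hS.preconnected ⟨x, hx⟩ ⟨y, hy⟩).exists_isPath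
  refine ⟨p.map (Embedding.induce S).toHom,
    hp.map (Embedding.induce (G := G) S).injective, fun z hz => ?_⟩
  obtain ⟨a, -, rfl⟩ := List.mem_map.1 (Walk.support_map .. ▸ hz)
  exact a.2

/-- Any three vertices of a connected set are the ends of a tripod inside that set. -/
theorem Connected.exists_tripod_of_induce {S : Set V} (hS : (G.induce S).Connected) {a b c : V}
    (ha : a ∈ S) (hb : b ∈ S) (hc : c ∈ S) :
    ∃ w, ∃ (p : G.Walk w a) (q : G.Walk w b) (r : G.Walk w c),
      (p.IsPath ∧ q.IsPath ∧ r.IsPath) ∧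
      (∀ x ∈ p.support, x ∈ S) ∧ (∀ x ∈ q.support, x ∈ S) ∧ (∀ x ∈ r.support, x ∈ S) ∧
      (∀ x ∈ p.support, x ∈ q.support → x = w) ∧
      (∀ x ∈ p.support, x ∈ r.support → x = w) ∧
      ∀ x ∈ q.support, x ∈ r.support → x = w := by
  obtain ⟨p, hp, hpS⟩ := hS.exists_isPath_of_induce ha hb
  obtain ⟨q, hq, hqS⟩ := hS.exists_isPath_of_induce hc ha
  obtain ⟨w, hw, r, hr, hrq, hrp⟩ :=
    q.exists_isPath_first_mem {x | x ∈ p.support} p.start_mem_support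
  obtain ⟨p₁, p₂, rfl⟩ := Walk.mem_support_iff_exists_append.1 hw
  rw [Walk.isPath_append_iff] at hp
  simp only [Set.mem_ofPred_eq, Walk.mem_support_append_iff] at hrp hpS
  refine ⟨w, p₁.reverse, p₂, r.reverse, ⟨hp.1.reverse, hp.2.1, hr.reverse⟩, ?_⟩
  simp only [Walk.support_reverse, List.mem_reverse]
  grind

/-- Three distinct paths with the same ends, pairwise internally disjoint. -/
structure IsTheta (p q r : G.Walk u v) : Prop where
  ne : u ≠ v
  isPath_fst : p.IsPath
  isPath_snd : q.IsPath
  isPath_trd : r.IsPath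
  fst_snd : ∀ x ∈ p.support, x ∈ q.support → x = u ∨ x = v
  fst_trd : ∀ x ∈ p.support, x ∈ r.support → x = u ∨ x = v
  snd_trd : ∀ x ∈ q.support, x ∈ r.support → x = u ∨ x = v
  edge_fst_snd : s(u, v) ∈ p.edges → s(u, v) ∉ q.edges
  edge_fst_trd : s(u, v) ∈ p.edges → s(u, v) ∉ r.edges
  edge_snd_trd : s(u, v) ∈ q.edges → s(u, v) ∉ r.edges

namespace IsTheta

variable {p q r : G.Walk u v}

theorem swap (h : IsTheta p q r) : IsTheta q p r where
  ne := h.ne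
  isPath_fst := h.isPath_snd
  isPath_snd := h.isPath_fst
  isPath_trd := h.isPath_trd
  fst_snd x hx hy := h.fst_snd x hy hx
  fst_trd := h.snd_trd
  snd_trd := h.fst_trd
  edge_fst_snd hx hy := h.edge_fst_snd hy hx
  edge_fst_trd := h.edge_snd_trd
  edge_snd_trd := h.edge_fst_trd

theorem rotate (h : IsTheta p q r) : IsTheta q r p where
  ne := h.ne
  isPath_fst := h.isPath_snd
  isPath_snd := h.isPath_trd
  isPath_trd := h.isPath_fst
  fst_snd := h.snd_trd
  fst_trd x hx hy := h.fst_snd x hy hx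
  snd_trd x hx hy := h.fst_trd x hy hx
  edge_fst_snd := h.edge_snd_trd
  edge_fst_trd hx hy := h.edge_fst_snd hy hx
  edge_snd_trd hx hy := h.edge_fst_trd hy hx

theorem reverse (h : IsTheta p q r) : IsTheta p.reverse q.reverse r.reverse := by
  constructor
  · exact h.ne.symm
  · exact h.isPath_fst.reverse
  · exact h.isPath_snd.reverse
  · exact h.isPath_trd.reverse
  all_goals
    simp only [Walk.support_reverse, Walk.edges_reverse, List.mem_reverse, Sym2.eq_swap (a := v)]
  · exact fun x hx hy => (h.fst_snd x hx hy).symm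
  · exact fun x hx hy => (h.fst_trd x hx hy).symm
  · exact fun x hx hy => (h.snd_trd x hx hy).symm
  · exact h.edge_fst_snd
  · exact h.edge_fst_trd
  · exact h.edge_snd_trd

theorem of_interior {a b : V} (huv : u ≠ v) (hp : p.IsPath) (hq : q.IsPath) (hr : r.IsPath)
    (hpq : ∀ x ∈ p.support, x ∈ q.support → x = u ∨ x = v)
    (hpr : ∀ x ∈ p.support, x ∈ r.support → x = u ∨ x = v)
    (hqr : ∀ x ∈ q.support, x ∈ r.support → x = u ∨ x = v)
    (ha : a ∈ p.support) (hau : a ≠ u) (hav : a ≠ v)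
    (hb : b ∈ q.support) (hbu : b ≠ u) (hbv : b ≠ v) : IsTheta p q r where
  ne := huv
  isPath_fst := hp
  isPath_snd := hq
  isPath_trd := hr
  fst_snd := hpq
  fst_trd := hpr
  snd_trd := hqr
  edge_fst_snd h := by have := hp.eq_or_eq_of_mem_edges h ha; tauto
  edge_fst_trd h := by have := hp.eq_or_eq_of_mem_edges h ha; tauto
  edge_snd_trd h := by have := hq.eq_or_eq_of_mem_edges h hb; tauto

theorem replace_fst (h : IsTheta p q r) {p' : G.Walk u v} (hp' : p'.IsPath)
    (hsup : p'.support ⊆ p.support)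
    (hq : s(u, v) ∈ p'.edges → s(u, v) ∉ q.edges)
    (hr : s(u, v) ∈ p'.edges → s(u, v) ∉ r.edges) : IsTheta p' q r where
  ne := h.ne
  isPath_fst := hp'
  isPath_snd := h.isPath_snd
  isPath_trd := h.isPath_trd
  fst_snd x hx := h.fst_snd x (hsup hx)
  fst_trd x hx := h.fst_trd x (hsup hx)
  snd_trd := h.snd_trd
  edge_fst_snd := hq
  edge_fst_trd := hr
  edge_snd_trd := h.edge_snd_trd

/-- An edge across the first two paths of a theta yields another theta. -/
theorem of_cross {p₁ : G.Walk u x} {p₂ : G.Walk x v} {q₁ : G.Walk u y} {q₂ : G.Walk y v}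
    (h : IsTheta (p₁.append p₂) (q₁.append q₂) r) (hxy : G.Adj x y)
    (hxu : x ≠ u) (hxv : x ≠ v) (hyu : y ≠ u) (hyv : y ≠ v) :
    IsTheta (Walk.cons hxy.symm p₂) (q₁.reverse.append r) q₂ := by
  obtain ⟨h0, h1, h2, h3, h4, h5, h6, -, -, -⟩ := h
  simp only [Walk.isPath_append_iff, Walk.mem_support_append_iff] at h1 h2 h4 h5 h6
  have := p₁.start_mem_support
  have := p₁.end_mem_support
  have := p₂.start_mem_support
  have := p₂.end_mem_support
  have := q₁.start_mem_support
  have := q₁.end_mem_support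
  have := q₂.start_mem_support
  have := q₂.end_mem_support
  have := r.start_mem_support
  have := r.end_mem_support
  apply of_interior (a := x) (b := u)
  all_goals
    try simp only [Walk.isPath_append_iff, Walk.mem_support_append_iff, Walk.cons_isPath_iff,
      Walk.support_cons, List.mem_cons, Walk.support_reverse, List.mem_reverse,
      Walk.isPath_reverse_iff]
    grind

end IsTheta
end SimpleGraph

theorem diamondGraph_adj_induction {R : Fin 4 → Fin 4 → Prop} (symm : ∀ a b, R a b → R b a)
    (h02 : R 0 2) (h03 : R 0 3) (h12 : R 1 2) (h13 : R 1 3) (h23 : R 2 3) :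
    ∀ a b, diamondGraph.Adj a b → R a b := by
  intro a b h
  fin_cases a <;> fin_cases b <;> simp [diamondGraph] at h ⊢ <;>
    first
    | assumption
    | (apply symm; assumption)

/-- A model whose branch sets lie in `S` is a model in the subgraph induced by `S`. -/
theorem IsMinorModel.hasMinor_induce {G : SimpleGraph α} {H : SimpleGraph β} {V : β → Set α}
    (hV : IsMinorModel G H V) {S : Set α} (hS : ∀ h, V h ⊆ S) : HasMinor (G.induce S) H := by
  obtain ⟨h1, h2, h3, h4⟩ := hV
  refine ⟨fun h => {x | x.1 ∈ V h}, fun h => ?_, fun a b hab => ?_, fun h => ?_, fun a b hab => ?_⟩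
  · obtain ⟨x, hx⟩ := h1 h
    exact ⟨⟨x, hS h hx⟩, hx⟩
  · exact Set.disjoint_left.2 fun x hx hy => Set.disjoint_left.1 (h2 hab) hx hy
  · let e : G.induce (V h) ≃g (G.induce S).induce {x | x.1 ∈ V h} :=
      { toFun := fun x => ⟨⟨x.1, hS h x.2⟩, x.2⟩
        invFun := fun x => ⟨x.1.1, x.2⟩
        left_inv := fun _ => rfl
        right_inv := fun _ => rfl
        map_rel_iff' := Iff.rfl }
    exact e.connected_iff.1 (h3 h)
  · obtain ⟨x, hx, y, hy, hxy⟩ := h4 a b hab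
    exact ⟨⟨x, hS a hx⟩, hx, ⟨y, hS b hy⟩, hy, hxy⟩

namespace SimpleGraph

variable {V : Type*} {G : SimpleGraph V} {u v w x y : V}

theorem Walk.IsPath.exists_walk_dropEnd {p : G.Walk u v} (hp : p.IsPath) (huv : u ≠ v) :
    ∃ d, ∃ m : G.Walk u d, G.Adj d v ∧ ∀ x, x ∈ m.support ↔ x ∈ p.support ∧ x ≠ v := by
  obtain ⟨q, rfl⟩ : ∃ q : G.Walk v u, p = q.reverse := ⟨p.reverse, p.reverse_reverse.symm⟩
  cases q with
  | nil => exact absurd rfl huv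
  | @cons _ d _ h m =>
    rw [Walk.isPath_reverse_iff, Walk.cons_isPath_iff] at hp
    refine ⟨d, m.reverse, h.symm, fun x => ?_⟩
    simp only [Walk.support_reverse, List.mem_reverse, Walk.support_cons, List.mem_cons]
    grind

theorem Walk.IsPath.exists_walk_interior {a : V} {p : G.Walk u v} (hp : p.IsPath) (huv : u ≠ v)
    (ha : a ∈ p.support) (hau : a ≠ u) (hav : a ≠ v) :
    ∃ c d, ∃ m : G.Walk c d, G.Adj u c ∧ G.Adj d v ∧
      ∀ x, x ∈ m.support ↔ x ∈ p.support ∧ x ≠ u ∧ x ≠ v := by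
  cases p with
  | nil => exact absurd rfl huv
  | @cons _ c _ h p =>
    rw [Walk.cons_isPath_iff] at hp
    have hcv : c ≠ v := by
      rintro rfl
      have := Walk.eq_nil_iff_nil.2 (Walk.isPath_iff_nil.1 hp.1)
      subst this
      simp [hau, hav] at ha
    obtain ⟨d, m, hd, hm⟩ := hp.1.exists_walk_dropEnd hcv
    refine ⟨c, d, m, h, hd, fun x => ?_⟩
    rw [hm, Walk.support_cons, List.mem_cons]
    grind

namespace IsTheta

variable {p q r : G.Walk u v}

/-- The paths of a theta can be reordered so that the first two have internal vertices. -/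
theorem exists_interior (h : IsTheta p q r) :
    ∃ p' q' r' : G.Walk u v, IsTheta p' q' r' ∧
      (∃ a ∈ p'.support, a ≠ u ∧ a ≠ v) ∧ (∃ b ∈ q'.support, b ≠ u ∧ b ≠ v) ∧
      (∀ x, (x ∈ p'.support ∨ x ∈ q'.support ∨ x ∈ r'.support) ↔
        (x ∈ p.support ∨ x ∈ q.support ∨ x ∈ r.support)) ∧
      ∀ e, (e ∈ p'.edges ∨ e ∈ q'.edges ∨ e ∈ r'.edges) ↔
        (e ∈ p.edges ∨ e ∈ q.edges ∨ e ∈ r.edges) := by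
  by_cases hp : s(u, v) ∈ p.edges
  · exact ⟨q, r, p, h.rotate,
      q.exists_interior_of_notMem_edges h.ne (h.edge_fst_snd hp),
      r.exists_interior_of_notMem_edges h.ne (h.edge_fst_trd hp), by tauto, by tauto⟩
  by_cases hq : s(u, v) ∈ q.edges
  · exact ⟨r, p, q, h.rotate.rotate,
      r.exists_interior_of_notMem_edges h.ne (h.edge_snd_trd hq),
      p.exists_interior_of_notMem_edges h.ne hp, by tauto, by tauto⟩
  · exact ⟨p, q, r, h, p.exists_interior_of_notMem_edges h.ne hp,
      q.exists_interior_of_notMem_edges h.ne hq, by simp, by simp⟩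

theorem hasMinor_induce (h : IsTheta p q r) {S : Set V} (hp : ∀ x ∈ p.support, x ∈ S)
    (hq : ∀ x ∈ q.support, x ∈ S) (hr : ∀ x ∈ r.support, x ∈ S) :
    HasMinor (G.induce S) diamondGraph := by
  obtain ⟨p', q', r', h', ⟨a, ha, hau, hav⟩, ⟨b, hb, hbu, hbv⟩, hsup, -⟩ := h.exists_interior
  have hS : ∀ x, (x ∈ p'.support ∨ x ∈ q'.support ∨ x ∈ r'.support) → x ∈ S := by
    intro x hx
    have := (hsup x).1 hx
    grind
  obtain ⟨c₀, d₀, m₀, hc₀, hd₀, hm₀⟩ := h'.isPath_fst.exists_walk_interior h'.ne ha hau hav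
  obtain ⟨c₁, d₁, m₁, hc₁, hd₁, hm₁⟩ := h'.isPath_snd.exists_walk_interior h'.ne hb hbu hbv
  obtain ⟨d₂, m₂, hd₂, hm₂⟩ := h'.isPath_trd.exists_walk_dropEnd h'.ne
  have h01 := h'.fst_snd
  have h02 := h'.fst_trd
  have h12 := h'.snd_trd
  refine IsMinorModel.hasMinor_induce
    (V := ![{x | x ∈ m₀.support}, {x | x ∈ m₁.support}, {x | x ∈ m₂.support}, {v}])
    ⟨?_, ?_, ?_, ?_⟩ ?_
  · intro i
    fin_cases i
    · exact ⟨c₀, m₀.start_mem_support⟩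
    · exact ⟨c₁, m₁.start_mem_support⟩
    · exact ⟨u, m₂.start_mem_support⟩
    · exact ⟨v, rfl⟩
  · intro i j hij
    refine Set.disjoint_left.2 ?_
    fin_cases i <;> fin_cases j <;> simp [hm₀, hm₁, hm₂] at hij ⊢ <;> grind
  · intro i
    fin_cases i
    · exact m₀.connected_induce_support
    · exact m₁.connected_induce_support
    · exact m₂.connected_induce_support
    · simp
  · apply diamondGraph_adj_induction
    · rintro a b ⟨x, hx, y, hy, hxy⟩
      exact ⟨y, hy, x, hx, hxy.symm⟩
    · exact ⟨c₀, m₀.start_mem_support, u, m₂.start_mem_support, hc₀.symm⟩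
    · exact ⟨d₀, m₀.end_mem_support, v, rfl, hd₀⟩
    · exact ⟨c₁, m₁.start_mem_support, u, m₂.start_mem_support, hc₁.symm⟩
    · exact ⟨d₁, m₁.end_mem_support, v, rfl, hd₁⟩
    · exact ⟨d₂, m₂.end_mem_support, v, rfl, hd₂⟩
  · intro i x hx
    apply hS
    have hv := p'.end_mem_support
    fin_cases i <;> simp [hm₀, hm₁, hm₂] at hx <;> grind

end IsTheta

theorem Walk.IsPath.append_cons {c d : V} {p : G.Walk u c} {q : G.Walk d v}
    (hp : p.IsPath) (hq : q.IsPath) (h : G.Adj c d)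
    (hpq : ∀ x ∈ p.support, x ∉ q.support) : (p.append (Walk.cons h q)).IsPath := by
  simp only [Walk.isPath_append_iff, Walk.cons_isPath_iff, Walk.support_cons, List.mem_cons]
  have := p.end_mem_support
  grind

theorem exists_isTheta_of_hasMinor (h : HasMinor G diamondGraph) :
    ∃ (u v : V) (p q r : G.Walk u v), IsTheta p q r := by
  obtain ⟨B, -, hdisj, hconn, hadj⟩ := h
  have hB : ∀ i j x, x ∈ B i → x ∈ B j → i = j := fun i j x hi hj => by
    by_contra hij
    exact Set.disjoint_left.1 (hdisj hij) hi hj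
  obtain ⟨a₀, ha₀, c₀, hc₀, e₀⟩ := hadj 2 0 (by simp [diamondGraph])
  obtain ⟨a₁, ha₁, c₁, hc₁, e₁⟩ := hadj 2 1 (by simp [diamondGraph])
  obtain ⟨a₂, ha₂, b₂, hb₂, e₂⟩ := hadj 2 3 (by simp [diamondGraph])
  obtain ⟨d₀, hd₀, b₀, hb₀, f₀⟩ := hadj 0 3 (by simp [diamondGraph])
  obtain ⟨d₁, hd₁, b₁, hb₁, f₁⟩ := hadj 1 3 (by simp [diamondGraph])
  obtain ⟨u, s₀, s₁, s₂, ⟨hs₀, hs₁, hs₂⟩, hsB₀, hsB₁, hsB₂, hs01, hs02, hs12⟩ :=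
    (hconn 2).exists_tripod_of_induce ha₀ ha₁ ha₂
  obtain ⟨v, t₀, t₁, t₂, ⟨ht₀, ht₁, ht₂⟩, htB₀, htB₁, htB₂, ht01, ht02, ht12⟩ :=
    (hconn 3).exists_tripod_of_induce hb₀ hb₁ hb₂
  obtain ⟨m₀, hm₀, hmB₀⟩ := (hconn 0).exists_isPath_of_induce hc₀ hd₀
  obtain ⟨m₁, hm₁, hmB₁⟩ := (hconn 1).exists_isPath_of_induce hc₁ hd₁
  have h01 : ∀ x, x ∈ B 0 → x ∉ B 1 := fun x h h' => by simpa using hB _ _ _ h h'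
  have h02 : ∀ x, x ∈ B 0 → x ∉ B 2 := fun x h h' => by simpa using hB _ _ _ h h'
  have h03 : ∀ x, x ∈ B 0 → x ∉ B 3 := fun x h h' => by simpa using hB _ _ _ h h'
  have h12 : ∀ x, x ∈ B 1 → x ∉ B 2 := fun x h h' => by simpa using hB _ _ _ h h'
  have h13 : ∀ x, x ∈ B 1 → x ∉ B 3 := fun x h h' => by simpa using hB _ _ _ h h'
  have h23 : ∀ x, x ∈ B 2 → x ∉ B 3 := fun x h h' => by simpa using hB _ _ _ h h'
  clear hB hdisj hconn hadj
  have hu : u ∈ B 2 := hsB₀ u s₀.start_mem_support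
  have hv : v ∈ B 3 := htB₀ v t₀.start_mem_support
  refine ⟨u, v, s₀.append (.cons e₀ (m₀.append (.cons f₀ t₀.reverse))),
    s₁.append (.cons e₁ (m₁.append (.cons f₁ t₁.reverse))),
    s₂.append (.cons e₂ t₂.reverse), IsTheta.of_interior (a := c₀) (b := c₁) ?_ ?_ ?_ ?_ ?_ ?_ ?_
      ?_ ?_ ?_ ?_ ?_ ?_⟩
  · grind
  · refine hs₀.append_cons (hm₀.append_cons ht₀.reverse f₀ ?_) e₀ ?_ <;>
    · simp only [Walk.mem_support_append_iff, Walk.support_cons, List.mem_cons,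
        Walk.support_reverse, List.mem_reverse]
      grind
  · refine hs₁.append_cons (hm₁.append_cons ht₁.reverse f₁ ?_) e₁ ?_ <;>
    · simp only [Walk.mem_support_append_iff, Walk.support_cons, List.mem_cons,
        Walk.support_reverse, List.mem_reverse]
      grind
  · refine hs₂.append_cons ht₂.reverse e₂ ?_
    simp only [Walk.support_reverse, List.mem_reverse]
    grind
  all_goals
    try simp only [Walk.mem_support_append_iff, Walk.support_cons, List.mem_cons,
        Walk.support_reverse, List.mem_reverse]
    grind [Walk.start_mem_support, Walk.end_mem_support]

theorem IsTheta.of_cross_trivial {p₁ : G.Walk u x} {p₂ : G.Walk x v} {q₁ : G.Walk u y}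
    {q₂ : G.Walk y v} {r : G.Walk u v}
    (hspan : ∀ (u v : V) (p q r : G.Walk u v), IsTheta p q r →
      ∀ z, z ∈ p.support ∨ z ∈ q.support ∨ z ∈ r.support)
    (h : IsTheta (p₁.append p₂) (q₁.append q₂) r) (hxy : G.Adj x y)
    (hxu : x ≠ u) (hxv : x ≠ v) (hyu : y ≠ u) (hyv : y ≠ v) :
    G.Adj u x ∧ ∀ z ∈ p₁.support, z = u ∨ z = x := by
  have key : ∀ z ∈ p₁.support, z = u ∨ z = x := by
    intro z hz
    have hs := hspan _ _ _ _ _ (h.of_cross hxy hxu hxv hyu hyv) z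
    obtain ⟨h0, h1, h2, h3, h4, h5, h6, -, -, -⟩ := h
    simp only [Walk.isPath_append_iff, Walk.mem_support_append_iff, Walk.support_cons,
      List.mem_cons, Walk.support_reverse, List.mem_reverse] at h1 h2 h4 h5 h6 hs
    have := p₂.end_mem_support
    have := q₁.end_mem_support
    grind
  refine ⟨?_, key⟩
  by_contra hux
  obtain ⟨z, hz, hzu, hzx⟩ := p₁.exists_interior_of_notMem_edges hxu.symm
    fun he => hux (p₁.adj_of_mem_edges he)
  have := key z hz
  tauto

/-- A graph all of whose thetas are spanning is `K₄` if some theta has an edge between internal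
vertices of two of its paths. -/
theorem IsTheta.nonempty_iso_top_of_cross {p q r : G.Walk u v}
    (hspan : ∀ (u v : V) (p q r : G.Walk u v), IsTheta p q r →
      ∀ z, z ∈ p.support ∨ z ∈ q.support ∨ z ∈ r.support)
    (h : IsTheta p q r) (hx : x ∈ p.support) (hy : y ∈ q.support) (hxy : G.Adj x y)
    (hxu : x ≠ u) (hxv : x ≠ v) (hyu : y ≠ u) (hyv : y ≠ v) :
    Nonempty (G ≃g (⊤ : SimpleGraph (Fin 4))) := by
  obtain ⟨p₁, p₂, rfl⟩ := Walk.mem_support_iff_exists_append.1 hx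
  obtain ⟨q₁, q₂, rfl⟩ := Walk.mem_support_iff_exists_append.1 hy
  have hrev := h.reverse
  rw [Walk.reverse_append, Walk.reverse_append] at hrev
  obtain ⟨hux, hp₁⟩ := h.of_cross_trivial hspan hxy hxu hxv hyu hyv
  obtain ⟨huy, hq₁⟩ := h.swap.of_cross_trivial hspan hxy.symm hyu hyv hxu hxv
  obtain ⟨hvx, hp₂⟩ := hrev.of_cross_trivial hspan hxy hxv hxu hyv hyu
  obtain ⟨hvy, hq₂⟩ := hrev.swap.of_cross_trivial hspan hxy.symm hyv hyu hxv hxu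
  have hθ : IsTheta (r.reverse.append q₁) (p₂.reverse.append (Walk.cons hxy .nil)) q₂.reverse := by
    have := (h.of_cross hxy hxu hxv hyu hyv).reverse.swap
    simpa [Walk.reverse_append, Walk.reverse_cons] using this
  obtain ⟨hvu, hr⟩ := hθ.of_cross_trivial hspan hux h.ne hyu.symm hxv hxy.ne
  simp only [Walk.support_reverse, List.mem_reverse] at hp₂ hq₂ hr
  have hall : ∀ z, z = u ∨ z = v ∨ z = x ∨ z = y := by
    intro z
    have := hspan _ _ _ _ _ h z
    simp only [Walk.mem_support_append_iff] at this
    grind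
  have hne := h.ne
  have hbij : Function.Bijective ![u, v, x, y] := by
    constructor
    · intro i j hij
      have := hxy.ne
      fin_cases i <;> fin_cases j <;> simp at hij ⊢ <;> grind
    · intro z
      rcases hall z with rfl | rfl | rfl | rfl
      exacts [⟨0, rfl⟩, ⟨1, rfl⟩, ⟨2, rfl⟩, ⟨3, rfl⟩]
  refine ⟨(⟨Equiv.ofBijective _ hbij, fun {i j} => ?_⟩ : (⊤ : SimpleGraph (Fin 4)) ≃g G).symm⟩
  fin_cases i <;> fin_cases j <;>
    simp [hux, huy, hvx, hvy, hvu, hxy, hux.symm, huy.symm, hvx.symm, hvy.symm, hvu.symm, hxy.symm]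

/-- In a graph all of whose thetas are spanning, the paths of a theta are induced. -/
theorem IsTheta.mem_edges_fst {p q r : G.Walk u v}
    (hspan : ∀ (u v : V) (p q r : G.Walk u v), IsTheta p q r →
      ∀ z, z ∈ p.support ∨ z ∈ q.support ∨ z ∈ r.support)
    (h : IsTheta p q r) (hx : x ∈ p.support) (hy : y ∈ p.support) (hxy : G.Adj x y) :
    s(x, y) ∈ p.edges ∨ s(x, y) ∈ q.edges ∨ s(x, y) ∈ r.edges := by
  by_contra! he
  obtain ⟨p', hp', hsub, hedge, z, hz, hz'⟩ := h.isPath_fst.exists_shortcut hx hy hxy he.1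
  have huv : s(u, v) ∈ p'.edges → s(u, v) = s(x, y) := fun huv =>
    (hedge _ huv).resolve_left fun h' => by
      rcases h.isPath_fst.eq_or_eq_of_mem_edges h' hz with rfl | rfl
      · exact hz' p'.start_mem_support
      · exact hz' p'.end_mem_support
  have hs := hspan _ _ _ _ _ (h.replace_fst hp' hsub (fun h' => huv h' ▸ he.2.1)
    fun h' => huv h' ▸ he.2.2) z
  have h1 := h.fst_snd z hz
  have h2 := h.fst_trd z hz
  have := p'.start_mem_support
  have := p'.end_mem_support
  grind

end SimpleGraph

/-- To give a subdivision it suffices to give one path per edge. -/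
theorem IsSubdivision.of_lt [LinearOrder β] {G : SimpleGraph α} {H : SimpleGraph β} (v : β → α)
    (hv : Function.Injective v) (P : ∀ a b : β, a < b → H.Adj a b → G.Walk (v a) (v b))
    (hpath : ∀ a b hab h, (P a b hab h).IsPath)
    (hdisj : ∀ a b hab h a' b' hab' h', s(a, b) ≠ s(a', b') →
      ∀ x, x ∈ (P a b hab h).support → x ∈ (P a' b' hab' h').support → x = v a ∨ x = v b)
    (hbranch : ∀ a b hab h c, v c ∈ (P a b hab h).support → c = a ∨ c = b)
    (hcover : ∀ x, (∃ c, x = v c) ∨ ∃ a b hab h, x ∈ (P a b hab h).support)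
    (hedges : ∀ x y, G.Adj x y → ∃ a b hab h, s(x, y) ∈ (P a b hab h).edges) :
    IsSubdivision G H := by
  let Q : ∀ ⦃a b : β⦄, H.Adj a b → G.Walk (v a) (v b) := fun a b h =>
    if hab : a < b then P a b hab h
    else (P b a (lt_of_le_of_ne (not_lt.1 hab) h.ne') h.symm).reverse
  have hQ : ∀ a b (hab : a < b) h, Q h = P a b hab h := fun a b hab h => dif_pos hab
  have hQ' : ∀ a b (hab : b < a) (h : H.Adj a b), Q h = (P b a hab h.symm).reverse :=
    fun a b hab h => dif_neg hab.not_gt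
  have hsymm : ∀ a b (h : H.Adj a b), Q h.symm = (Q h).reverse := by
    intro a b h
    rcases lt_or_gt_of_ne h.ne with hab | hab
    · rw [hQ _ _ hab, hQ' _ _ hab]
    · rw [hQ _ _ hab, hQ' _ _ hab, SimpleGraph.Walk.reverse_reverse]
  have hrep : ∀ a b (h : H.Adj a b), ∃ a' b', ∃ (hab : a' < b') (h' : H.Adj a' b'),
      s(a, b) = s(a', b') ∧ (∀ x, x ∈ (Q h).support ↔ x ∈ (P a' b' hab h').support) := by
    intro a b h
    rcases lt_or_gt_of_ne h.ne with hab | hab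
    · exact ⟨a, b, hab, h, rfl, fun x => by rw [hQ _ _ hab]⟩
    · exact ⟨b, a, hab, h.symm, Sym2.eq_swap, fun x => by simp [hQ' _ _ hab]⟩
  refine ⟨v, hv, Q, ?_, hsymm, ?_, ?_, ?_, ?_⟩
  · intro a b h
    rcases lt_or_gt_of_ne h.ne with hab | hab
    · rw [hQ _ _ hab]
      exact hpath ..
    · rw [hQ' _ _ hab]
      exact (hpath ..).reverse
  · intro a b h a' b' h' hne x hx hx'
    obtain ⟨c, d, hcd, k, e, hs⟩ := hrep a b h
    obtain ⟨c', d', hcd', k', e', hs'⟩ := hrep a' b' h'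
    have := hdisj c d hcd k c' d' hcd' k' (e ▸ e' ▸ hne) x ((hs x).1 hx) ((hs' x).1 hx')
    rcases Sym2.eq_iff.1 e with ⟨rfl, rfl⟩ | ⟨rfl, rfl⟩
    · exact this
    · exact this.symm
  · intro a b h c hc
    obtain ⟨a', b', hab, k, e, hs⟩ := hrep a b h
    have := hbranch a' b' hab k c ((hs _).1 hc)
    rcases Sym2.eq_iff.1 e with ⟨rfl, rfl⟩ | ⟨rfl, rfl⟩
    · exact this
    · exact this.symm
  · intro x
    refine (hcover x).imp_right ?_
    rintro ⟨a, b, hab, h, hx⟩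
    exact ⟨a, b, h, by rwa [hQ _ _ hab]⟩
  · refine fun x y => ⟨fun hxy => ?_, fun ⟨a, b, h, hx⟩ => (Q h).adj_of_mem_edges hx⟩
    obtain ⟨a, b, hab, h, hx⟩ := hedges x y hxy
    exact ⟨a, b, h, by rwa [hQ _ _ hab]⟩

namespace SimpleGraph

variable {V : Type*} {G : SimpleGraph V} {u v a b : V}

theorem IsTheta.isSubdivision_of_interior {p q r : G.Walk u v} (h : IsTheta p q r)
    (ha : a ∈ p.support) (hau : a ≠ u) (hav : a ≠ v)
    (hb : b ∈ q.support) (hbu : b ≠ u) (hbv : b ≠ v)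
    (hspan : ∀ z, z ∈ p.support ∨ z ∈ q.support ∨ z ∈ r.support)
    (hedges : ∀ x y, G.Adj x y → s(x, y) ∈ p.edges ∨ s(x, y) ∈ q.edges ∨ s(x, y) ∈ r.edges) :
    IsSubdivision G diamondGraph := by
  obtain ⟨p₁, p₂, rfl⟩ := Walk.mem_support_iff_exists_append.1 ha
  obtain ⟨q₁, q₂, rfl⟩ := Walk.mem_support_iff_exists_append.1 hb
  obtain ⟨h0, h1, h2, h3, h4, h5, h6, -, -, -⟩ := h
  simp only [Walk.isPath_append_iff, Walk.mem_support_append_iff, Walk.edges_append,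
    List.mem_append] at h1 h2 h4 h5 h6 hspan hedges
  obtain ⟨hp₁, hp₂, h1⟩ := h1
  obtain ⟨hq₁, hq₂, h2⟩ := h2
  clear ha hb
  let P : ∀ i j : Fin 4, i < j → diamondGraph.Adj i j →
      G.Walk ((![a, b, u, v] : Fin 4 → V) i) ((![a, b, u, v] : Fin 4 → V) j) := fun i j hij h =>
    match i, j, hij, h with
    | 0, 2, _, _ => p₁.reverse
    | 0, 3, _, _ => p₂
    | 1, 2, _, _ => q₁.reverse
    | 1, 3, _, _ => q₂
    | 2, 3, _, _ => r
    | 0, 1, _, h => absurd h (by simp [diamondGraph])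
    | 3, j, hij, _ => absurd hij (Fin.le_last j).not_gt
  have s02 : ∀ h h' x, x ∈ (P 0 2 h h').support ↔ x ∈ p₁.support := fun _ _ x => by
    change x ∈ p₁.reverse.support ↔ _
    rw [Walk.support_reverse, List.mem_reverse]
  have s03 : ∀ h h' x, x ∈ (P 0 3 h h').support ↔ x ∈ p₂.support := fun _ _ _ => Iff.rfl
  have s12 : ∀ h h' x, x ∈ (P 1 2 h h').support ↔ x ∈ q₁.support := fun _ _ x => by
    change x ∈ q₁.reverse.support ↔ _
    rw [Walk.support_reverse, List.mem_reverse]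
  have s13 : ∀ h h' x, x ∈ (P 1 3 h h').support ↔ x ∈ q₂.support := fun _ _ _ => Iff.rfl
  have s23 : ∀ h h' x, x ∈ (P 2 3 h h').support ↔ x ∈ r.support := fun _ _ _ => Iff.rfl
  have hcases : ∀ i j : Fin 4, i < j → diamondGraph.Adj i j →
      (i = 0 ∧ j = 2) ∨ (i = 0 ∧ j = 3) ∨ (i = 1 ∧ j = 2) ∨ (i = 1 ∧ j = 3) ∨
        (i = 2 ∧ j = 3) := by
    intro i j hij h
    fin_cases i <;> fin_cases j <;> simp [diamondGraph] at hij h ⊢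
  have a02 : diamondGraph.Adj 0 2 := by simp [diamondGraph]
  have a03 : diamondGraph.Adj 0 3 := by simp [diamondGraph]
  have a12 : diamondGraph.Adj 1 2 := by simp [diamondGraph]
  have a13 : diamondGraph.Adj 1 3 := by simp [diamondGraph]
  have a23 : diamondGraph.Adj 2 3 := by simp [diamondGraph]
  have := p₁.start_mem_support
  have := p₁.end_mem_support
  have := p₂.start_mem_support
  have := p₂.end_mem_support
  have := q₁.start_mem_support
  have := q₁.end_mem_support
  have := q₂.start_mem_support
  have := q₂.end_mem_support
  have := r.start_mem_support
  have := r.end_mem_support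
  refine IsSubdivision.of_lt _ ?_ P ?_ ?_ ?_ ?_ ?_
  · intro i j hij
    fin_cases i <;> fin_cases j <;> simp at hij ⊢ <;> grind
  · intro i j hij h
    rcases hcases i j hij h with ⟨rfl, rfl⟩ | ⟨rfl, rfl⟩ | ⟨rfl, rfl⟩ | ⟨rfl, rfl⟩ | ⟨rfl, rfl⟩
    exacts [hp₁.reverse, hp₂, hq₁.reverse, hq₂, h3]
  · intro i j hij h i' j' hij' h' hne x hx hx'
    clear_value P
    rcases hcases i j hij h with ⟨rfl, rfl⟩ | ⟨rfl, rfl⟩ | ⟨rfl, rfl⟩ | ⟨rfl, rfl⟩ | ⟨rfl, rfl⟩ <;>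
    rcases hcases i' j' hij' h' with
      ⟨rfl, rfl⟩ | ⟨rfl, rfl⟩ | ⟨rfl, rfl⟩ | ⟨rfl, rfl⟩ | ⟨rfl, rfl⟩ <;>
    first
    | exact absurd rfl hne
    | simp only [s02, s03, s12, s13, s23] at hx hx'
      simp only [Matrix.cons_val]
      clear s02 s03 s12 s13 s23 P
      grind
  · intro i j hij h c hc
    clear_value P
    rcases hcases i j hij h with ⟨rfl, rfl⟩ | ⟨rfl, rfl⟩ | ⟨rfl, rfl⟩ | ⟨rfl, rfl⟩ | ⟨rfl, rfl⟩ <;>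
    · simp only [s02, s03, s12, s13, s23] at hc
      clear s02 s03 s12 s13 s23 P
      fin_cases c <;> simp at hc ⊢ <;> grind
  · intro x
    right
    rcases hspan x with (hx | hx) | (hx | hx) | hx
    · exact ⟨0, 2, by decide, a02, (s02 (by decide) a02 x).2 hx⟩
    · exact ⟨0, 3, by decide, a03, (s03 (by decide) a03 x).2 hx⟩
    · exact ⟨1, 2, by decide, a12, (s12 (by decide) a12 x).2 hx⟩
    · exact ⟨1, 3, by decide, a13, (s13 (by decide) a13 x).2 hx⟩
    · exact ⟨2, 3, by decide, a23, (s23 (by decide) a23 x).2 hx⟩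
  · intro x y hxy
    rcases hedges x y hxy with (hx | hx) | (hx | hx) | hx
    · refine ⟨0, 2, by decide, a02, (?_ : s(x, y) ∈ p₁.reverse.edges)⟩
      simpa using hx
    · exact ⟨0, 3, by decide, a03, hx⟩
    · refine ⟨1, 2, by decide, a12, (?_ : s(x, y) ∈ q₁.reverse.edges)⟩
      simpa using hx
    · exact ⟨1, 3, by decide, a13, hx⟩
    · exact ⟨2, 3, by decide, a23, hx⟩

theorem IsTheta.isSubdivision {p q r : G.Walk u v} (h : IsTheta p q r)
    (hspan : ∀ z, z ∈ p.support ∨ z ∈ q.support ∨ z ∈ r.support)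
    (hedges : ∀ x y, G.Adj x y → s(x, y) ∈ p.edges ∨ s(x, y) ∈ q.edges ∨ s(x, y) ∈ r.edges) :
    IsSubdivision G diamondGraph := by
  obtain ⟨p', q', r', h', ⟨a, ha, hau, hav⟩, ⟨b, hb, hbu, hbv⟩, hsup, hedg⟩ := h.exists_interior
  exact h'.isSubdivision_of_interior ha hau hav hb hbu hbv (fun z => (hsup z).2 (hspan z))
    fun x y hxy => (hedg _).2 (hedges x y hxy)

/-- In a graph all of whose thetas are spanning, an edge outside a theta whose first path contains
one of its ends makes the graph a `K₄`. -/
theorem IsTheta.nonempty_iso_top_of_notMem_edges {x y : V} {p q r : G.Walk u v}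
    (hspan : ∀ (u v : V) (p q r : G.Walk u v), IsTheta p q r →
      ∀ z, z ∈ p.support ∨ z ∈ q.support ∨ z ∈ r.support)
    (h : IsTheta p q r) (hx : x ∈ p.support) (hxy : G.Adj x y)
    (he : ¬ (s(x, y) ∈ p.edges ∨ s(x, y) ∈ q.edges ∨ s(x, y) ∈ r.edges)) :
    Nonempty (G ≃g (⊤ : SimpleGraph (Fin 4))) := by
  have hp : ¬ (x ∈ p.support ∧ y ∈ p.support) := fun ⟨h₁, h₂⟩ =>
    he (h.mem_edges_fst hspan h₁ h₂ hxy)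
  have hq : ¬ (x ∈ q.support ∧ y ∈ q.support) := fun ⟨h₁, h₂⟩ => by
    have := h.rotate.mem_edges_fst hspan h₁ h₂ hxy
    tauto
  have hr : ¬ (x ∈ r.support ∧ y ∈ r.support) := fun ⟨h₁, h₂⟩ => by
    have := h.rotate.rotate.mem_edges_fst hspan h₁ h₂ hxy
    tauto
  have := p.start_mem_support
  have := p.end_mem_support
  have := q.start_mem_support
  have := q.end_mem_support
  have := r.start_mem_support
  have := r.end_mem_support
  rcases hspan _ _ _ _ _ h y with hy | hy | hy
  · exact absurd ⟨hx, hy⟩ hp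
  · apply h.nonempty_iso_top_of_cross hspan hx hy hxy <;> rintro rfl <;> tauto
  · apply h.rotate.rotate.swap.nonempty_iso_top_of_cross hspan hx hy hxy <;> rintro rfl <;> tauto

end SimpleGraph

/-- Every connected diamond-minimal graph is isomorphic to `K₄` or is a subdivision
of the diamond. -/
theorem diamond_minimal (G : SimpleGraph α) (hconn : G.Connected)
    (hmin : MinorMinimal G diamondGraph) :
    Nonempty (G ≃g (⊤ : SimpleGraph (Fin 4))) ∨ IsSubdivision G diamondGraph := by
  have hspan : ∀ (u v : α) (p q r : G.Walk u v), IsTheta p q r →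
      ∀ z, z ∈ p.support ∨ z ∈ q.support ∨ z ∈ r.support := by
    intro u v p q r h z
    by_contra! hz
    exact hmin.2 z <| h.hasMinor_induce (fun x hx hxz => hz.1 (hxz ▸ hx))
      (fun x hx hxz => hz.2.1 (hxz ▸ hx)) (fun x hx hxz => hz.2.2 (hxz ▸ hx))
  obtain ⟨u, v, p, q, r, h⟩ := exists_isTheta_of_hasMinor hmin.1
  by_cases hedges : ∀ x y, G.Adj x y →
      s(x, y) ∈ p.edges ∨ s(x, y) ∈ q.edges ∨ s(x, y) ∈ r.edges
  · exact .inr (h.isSubdivision (hspan _ _ _ _ _ h) hedges)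
  · push Not at hedges
    obtain ⟨x, y, hxy, hp, hq, hr⟩ := hedges
    left
    rcases hspan _ _ _ _ _ h x with hx | hx | hx
    · exact h.nonempty_iso_top_of_notMem_edges hspan hx hxy (by tauto)
    · exact h.rotate.nonempty_iso_top_of_notMem_edges hspan hx hxy (by tauto)
    · exact h.rotate.rotate.nonempty_iso_top_of_notMem_edges hspan hx hxy (by tauto)
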